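/- Let d ≥ 3, let 1 ≤ k ≤ d − 2 and n ≥ 2, let P be a d-polytope in ℝ^d, and let 𝒫 = {xᵢ + τᵢP : xᵢ ∈ ℝ^d, τᵢ > 0, i = 1, …, n} be a weakly k-impassable family of positive homothets of P. Then conv(⋃𝒫) is a summand of (Σᵢ₌₁ⁿ τᵢ)P: there exists a nonempty compact convex set K′ ⊂ ℝ^d such that conv(⋃𝒫) + K′ = (Σᵢ₌₁ⁿ τᵢ)P. In particular, some translate of (Σᵢ₌₁ⁿ τᵢ)P contains ⋃𝒫. -/

import Mathlib

open Set Metric Pointwise MeasureTheory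

noncomputable section

abbrev Euc (d : ℕ) := EuclideanSpace ℝ (Fin d)

variable {d : ℕ}

/-- A convex body: compact, convex, with nonempty interior. -/
def IsConvexBody (K : Set (Euc d)) : Prop :=
  IsCompact K ∧ Convex ℝ K ∧ (interior K).Nonempty

/-- A hyperplane of `ℝ^d`. -/
def IsHyperplane (H : Set (Euc d)) : Prop :=
  ∃ u : Euc d, u ≠ 0 ∧ ∃ c : ℝ, H = {x : Euc d | (inner ℝ x u : ℝ) = c}

/-- A straight line in `ℝ^d`. -/
def IsLine (L : Set (Euc d)) : Prop :=
  ∃ p v : Euc d, v ≠ 0 ∧ L = {x : Euc d | ∃ t : ℝ, x = p + t • v}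

/-- A `d`-polytope: convex hull of finitely many points, with nonempty interior. -/
def IsPolytope (P : Set (Euc d)) : Prop :=
  ∃ S : Finset (Euc d), P = convexHull ℝ (S : Set (Euc d)) ∧ (interior P).Nonempty

/-- A `d`-simplex: convex hull of `d+1` affinely independent points. -/
def IsSimplex (d : ℕ) (T : Set (Euc d)) : Prop :=
  ∃ v : Fin (d + 1) → Euc d, AffineIndependent ℝ v ∧ T = convexHull ℝ (Set.range v)

/-- The exposed face of `P` in direction `u`. -/
def exposedFaceAt (P : Set (Euc d)) (u : Euc d) : Set (Euc d) :=
  {x ∈ P | ∀ y ∈ P, (inner ℝ y u : ℝ) ≤ (inner ℝ x u : ℝ)}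

/-- `u` is the outer unit normal vector of a facet of `P`. -/
def IsFacetNormal (P : Set (Euc d)) (u : Euc d) : Prop :=
  ‖u‖ = 1 ∧ Module.finrank ℝ (affineSpan ℝ (exposedFaceAt P u)).direction = d - 1

/-- The hyperplane `H` is parallel to some facet of `P`:
some translate of `H` contains the facet. -/
def HypParallelToFacet (P H : Set (Euc d)) : Prop :=
  ∃ u : Euc d, IsFacetNormal P u ∧ ∃ v : Euc d, exposedFaceAt P u ⊆ (fun x => v + x) '' H

/-- The positive homothet `x + τ • P`. -/
def homo (x : Euc d) (τ : ℝ) (P : Set (Euc d)) : Set (Euc d) := {x} + τ • P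

/-- A weakly non-separable family of positive homothets of the polytope `P`. -/
def WNS (P : Set (Euc d)) {n : ℕ} (x : Fin n → Euc d) (τ : Fin n → ℝ) : Prop :=
  ∀ H : Set (Euc d), IsHyperplane H → HypParallelToFacet P H →
    (H ∩ convexHull ℝ (⋃ i, homo (x i) (τ i) P)).Nonempty →
    ∃ i, (H ∩ homo (x i) (τ i) P).Nonempty

/-- A non-separable family of convex bodies. -/
def NS {n : ℕ} (F : Fin n → Set (Euc d)) : Prop :=
  ∀ H : Set (Euc d), IsHyperplane H →
    (H ∩ convexHull ℝ (⋃ i, F i)).Nonempty → ∃ i, (H ∩ F i).Nonempty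

/-- `A` is a `k`-dimensional affine subspace of `ℝ^d` (as a set). -/
def IsAffSub (k : ℕ) (A : Set (Euc d)) : Prop :=
  ∃ S : AffineSubspace ℝ (Euc d), (S : Set (Euc d)) = A ∧ A.Nonempty ∧
    Module.finrank ℝ S.direction = k

/-- The affine subspace `A` is parallel to some facet of `P`:
some translate of `A` is contained in the affine hull of the facet. -/
def SubParallelToFacet (P A : Set (Euc d)) : Prop :=
  ∃ u : Euc d, IsFacetNormal P u ∧ ∃ v : Euc d,
    (fun x => v + x) '' A ⊆ (affineSpan ℝ (exposedFaceAt P u) : Set (Euc d))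

/-- A weakly `k`-impassable family of positive homothets of the polytope `P`. -/
def WIP (k : ℕ) (P : Set (Euc d)) {n : ℕ} (x : Fin n → Euc d) (τ : Fin n → ℝ) : Prop :=
  ∀ A : Set (Euc d), IsAffSub k A → SubParallelToFacet P A →
    (A ∩ convexHull ℝ (⋃ i, homo (x i) (τ i) P)).Nonempty →
    ∃ i, (A ∩ homo (x i) (τ i) P).Nonempty

/-- A full-rank lattice in `ℝ^d`. -/
def IsFullLattice (L : Set (Euc d)) : Prop :=
  ∃ b : Module.Basis (Fin d) ℝ (Euc d),
    L = Set.range fun z : Fin d → ℤ => ∑ i, (z i : ℝ) • b i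

/-- The integer lattice `ℤ^d` as a subset of `ℝ^d`. -/
def intLattice (d : ℕ) : Set (Euc d) := {x : Euc d | ∀ i, ∃ z : ℤ, x i = (z : ℝ)}

/-- The unit cube `[0,1]^d`. -/
def unitCube (d : ℕ) : Set (Euc d) := {x : Euc d | ∀ i, x i ∈ Set.Icc (0 : ℝ) 1}

/-- The axis-parallel hyperplane `{x : x_j = c}`. -/
def axisHyp (d : ℕ) (j : Fin d) (c : ℝ) : Set (Euc d) := {x : Euc d | x j = c}

/-- A weakly non-separable family of translates of the unit cube. -/
def CubeWNS {d n : ℕ} (p : Fin n → Euc d) : Prop :=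
  ∀ (j : Fin d) (c : ℝ),
    (axisHyp d j c ∩ convexHull ℝ (⋃ k, {p k} + unitCube d)).Nonempty →
    ∃ k, (axisHyp d j c ∩ ({p k} + unitCube d)).Nonempty


lemma mem_homo {x z : Euc d} {τ : ℝ} {P : Set (Euc d)} :
    z ∈ homo x τ P ↔ ∃ p ∈ P, x + τ • p = z := by
  simp [homo, Set.mem_smul_set, eq_neg_add_iff_add_eq]

lemma exists_submodule_le_finrank_eq {V : Submodule ℝ (Euc d)} {k : ℕ}
    (hk : k ≤ Module.finrank ℝ V) : ∃ W ≤ V, Module.finrank ℝ W = k := by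
  obtain ⟨f, hf⟩ := exists_linearIndependent_of_le_finrank hk
  refine ⟨Submodule.span ℝ (Set.range (V.subtype ∘ f)), ?_, ?_⟩
  · rw [Submodule.span_le]
    rintro _ ⟨i, rfl⟩
    exact (f i).2
  · rw [finrank_span_eq_card (hf.map' V.subtype V.ker_subtype), Fintype.card_fin]

lemma finrank_orthogonal_singleton {u : Euc d} (hu : u ≠ 0) :
    Module.finrank ℝ (ℝ ∙ u)ᗮ = d - 1 := by
  have h := Submodule.finrank_add_finrank_orthogonal (ℝ ∙ u)
  rw [finrank_span_singleton hu, finrank_euclideanSpace_fin] at h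
  omega

lemma direction_exposedFaceAt_le (P : Set (Euc d)) (u : Euc d) :
    (affineSpan ℝ (exposedFaceAt P u)).direction ≤ (ℝ ∙ u)ᗮ := by
  rw [direction_affineSpan, vectorSpan_def, Submodule.span_le]
  rintro _ ⟨a, ha, b, hb, rfl⟩
  rw [SetLike.mem_coe, Submodule.mem_orthogonal_singleton_iff_inner_left]
  change (inner ℝ (a - b) u : ℝ) = 0
  rw [inner_sub_left]
  linarith [ha.2 b hb.1, hb.2 a ha.1]

lemma IsFacetNormal.ne_zero {P : Set (Euc d)} {u : Euc d} (hu : IsFacetNormal P u) : u ≠ 0 := by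
  rintro rfl
  simpa using hu.1

lemma IsFacetNormal.direction_eq {P : Set (Euc d)} {u : Euc d} (hu : IsFacetNormal P u) :
    (affineSpan ℝ (exposedFaceAt P u)).direction = (ℝ ∙ u)ᗮ :=
  Submodule.eq_of_le_of_finrank_eq (direction_exposedFaceAt_le P u)
    (by rw [hu.2, finrank_orthogonal_singleton hu.ne_zero])

lemma IsPolytope.isCompact {P : Set (Euc d)} (hP : IsPolytope P) : IsCompact P := by
  obtain ⟨S, rfl, -⟩ := hP
  exact S.finite_toSet.isCompact_convexHull ℝ

lemma IsPolytope.convex {P : Set (Euc d)} (hP : IsPolytope P) : Convex ℝ P := by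
  obtain ⟨S, rfl, -⟩ := hP
  exact convex_convexHull ℝ _

lemma IsPolytope.nonempty {P : Set (Euc d)} (hP : IsPolytope P) : P.Nonempty := by
  obtain ⟨S, rfl, h⟩ := hP
  exact h.mono interior_subset

lemma inner_le_of_mem_convexHull {s : Set (Euc d)} {u : Euc d} {c : ℝ}
    (h : ∀ a ∈ s, (inner ℝ a u : ℝ) ≤ c) {a : Euc d} (ha : a ∈ convexHull ℝ s) :
    (inner ℝ a u : ℝ) ≤ c := by
  have hconv : Convex ℝ {a : Euc d | (inner ℝ a u : ℝ) ≤ c} := by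
    refine convex_halfSpace_le ⟨fun a b => inner_add_left a b u, fun r a => ?_⟩ c
    rw [real_inner_smul_left, smul_eq_mul]
  exact convexHull_min (t := {a | (inner ℝ a u : ℝ) ≤ c}) h hconv ha

/-- A closed convex set and a point outside it are strictly separated by a linear functional,
represented by a vector. -/
lemma exists_inner_lt_lt {s : Set (Euc d)} (hs : Convex ℝ s) (hc : IsClosed s) {z : Euc d}
    (hz : z ∉ s) : ∃ (w : Euc d) (c : ℝ), (∀ a ∈ s, (inner ℝ a w : ℝ) < c) ∧
      c < (inner ℝ z w : ℝ) := by
  obtain ⟨f, c, h1, h2⟩ := geometric_hahn_banach_closed_point hs hc hz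
  refine ⟨(InnerProductSpace.toDual ℝ (Euc d)).symm f, c, fun a ha => ?_, ?_⟩
  · rw [real_inner_comm, InnerProductSpace.toDual_symm_apply]
    exact h1 a ha
  · rw [real_inner_comm, InnerProductSpace.toDual_symm_apply]
    exact h2

/-- The polar dual of a finite set of points with respect to a center `p`. -/
def polarAt (S : Finset (Euc d)) (p : Euc d) : Set (Euc d) :=
  {u | ∀ s ∈ S, (inner ℝ (s - p) u : ℝ) ≤ 1}

lemma isCompact_polarAt {S : Finset (Euc d)} {p : Euc d}
    (hp : p ∈ interior (convexHull ℝ (S : Set (Euc d)))) : IsCompact (polarAt S p) := by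
  obtain ⟨r, hr, hball⟩ := Metric.nhds_basis_closedBall.mem_iff.1 (mem_interior_iff_mem_nhds.1 hp)
  refine Metric.isCompact_of_isClosed_isBounded ?_ ?_
  · simp only [polarAt, ofPred_forall]
    exact isClosed_biInter fun s _ => isClosed_le (by fun_prop) continuous_const
  · refine (Metric.isBounded_iff_subset_closedBall 0).2 ⟨1 / r, fun u hu => ?_⟩
    rw [mem_closedBall_zero_iff]
    rcases eq_or_ne u 0 with rfl | hu0
    · simpa using hr.le
    have hn : 0 < ‖u‖ := norm_pos_iff.2 hu0
    have hmem : p + (r / ‖u‖) • u ∈ convexHull ℝ (S : Set (Euc d)) := by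
      apply hball
      rw [mem_closedBall_iff_norm, add_sub_cancel_left, norm_smul,
        Real.norm_of_nonneg (by positivity)]
      exact (div_mul_cancel₀ r hn.ne').le
    have h := inner_le_of_mem_convexHull (u := u) (c := 1 + inner ℝ p u)
      (fun s hs => by have := hu s hs; rw [inner_sub_left] at this; linarith) hmem
    rw [inner_add_left, real_inner_smul_left, real_inner_self_eq_norm_sq] at h
    have h' : r / ‖u‖ * ‖u‖ ^ 2 = r * ‖u‖ := by field_simp
    rw [le_div_iff₀ hr]
    linarith

/-- A feasible point of a finite system of linear inequalities can be moved a little in both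
directions along any line orthogonal to the active constraints. -/
lemma exists_pos_add_sub_mem_polarAt {S : Finset (Euc d)} {p u y : Euc d} (hu : u ∈ polarAt S p)
    (hy : ∀ s ∈ S, (inner ℝ (s - p) u : ℝ) = 1 → (inner ℝ (s - p) y : ℝ) = 0) :
    ∃ ε : ℝ, 0 < ε ∧ u + ε • y ∈ polarAt S p ∧ u - ε • y ∈ polarAt S p := by
  have key : ∀ᶠ ε : ℝ in nhdsWithin 0 (Ioi 0), ∀ s ∈ S,
      ε * |(inner ℝ (s - p) y : ℝ)| ≤ 1 - inner ℝ (s - p) u := by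
    rw [Filter.eventually_all_finset]
    intro s hs
    rcases (hu s hs).eq_or_lt with h | h
    · simp [hy s hs h, h]
    · have hcont : Continuous fun ε : ℝ => ε * |(inner ℝ (s - p) y : ℝ)| := by fun_prop
      have ht := (hcont.tendsto 0).mono_left (nhdsWithin_le_nhds (s := Ioi 0))
      rw [zero_mul] at ht
      exact ht.eventually_le_const (by linarith)
  obtain ⟨ε, hε, hpos⟩ := (key.and self_mem_nhdsWithin).exists
  have hpos : 0 < ε := hpos
  refine ⟨ε, hpos, fun s hs => ?_, fun s hs => ?_⟩
  · rw [inner_add_right, real_inner_smul_right]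
    nlinarith [hε s hs, le_abs_self (inner ℝ (s - p) y : ℝ)]
  · rw [inner_sub_right, real_inner_smul_right]
    nlinarith [hε s hs, neg_abs_le (inner ℝ (s - p) y : ℝ)]

/-- If the points of an exposed face, seen from a point off its hyperplane, span the whole
space, then the face is a facet. -/
lemma isFacetNormal_of_span_eq_top {P T : Set (Euc d)} {p u : Euc d} (hu : ‖u‖ = 1)
    (hT : T ⊆ exposedFaceAt P u) (hspan : Submodule.span ℝ ((fun s => s - p) '' T) = ⊤) :
    IsFacetNormal P u := by
  refine ⟨hu, le_antisymm ?_ ?_⟩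
  · have hu0 : u ≠ 0 := by rintro rfl; simp at hu
    rw [← finrank_orthogonal_singleton hu0]
    exact Submodule.finrank_mono (direction_exposedFaceAt_le P u)
  · rcases T.eq_empty_or_nonempty with rfl | ⟨t, ht⟩
    · simp only [image_empty, Submodule.span_empty] at hspan
      have h := congrArg (fun V : Submodule ℝ (Euc d) => Module.finrank ℝ V) hspan
      simp only [finrank_bot, finrank_top, finrank_euclideanSpace_fin] at h
      omega
    · set V := (affineSpan ℝ (exposedFaceAt P u)).direction
      have hle : (⊤ : Submodule ℝ (Euc d)) ≤ (ℝ ∙ (t - p)) ⊔ V := by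
        rw [← hspan, Submodule.span_le]
        rintro _ ⟨s, hs, rfl⟩
        have : s - p = (t - p) + (s - t) := by abel
        change s - p ∈ (ℝ ∙ (t - p)) ⊔ V
        rw [this]
        exact Submodule.add_mem_sup (Submodule.mem_span_singleton_self _)
          (AffineSubspace.vsub_mem_direction (subset_affineSpan ℝ _ (hT hs))
            (subset_affineSpan ℝ _ (hT ht)))
      have h1 := Submodule.finrank_mono hle
      have h2 := Submodule.finrank_add_le_finrank_add_finrank (ℝ ∙ (t - p)) V
      have h3 := finrank_span_le_card (R := ℝ) ({t - p} : Set (Euc d))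
      simp only [toFinset_singleton, Finset.card_singleton] at h3
      rw [finrank_top, finrank_euclideanSpace_fin] at h1
      omega

/-- A point outside a polytope is cut off by the hyperplane of some facet. -/
lemma IsPolytope.exists_isFacetNormal_forall_lt {P : Set (Euc d)} (hP : IsPolytope P) {z : Euc d}
    (hz : z ∉ P) : ∃ u, IsFacetNormal P u ∧ ∀ a ∈ P, (inner ℝ a u : ℝ) < inner ℝ z u := by
  have hPc := hP.isCompact
  have hPconv := hP.convex
  obtain ⟨S, rfl, p, hp⟩ := hP
  obtain ⟨w, c, hw, hcz⟩ := exists_inner_lt_lt hPconv hPc.isClosed hz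
  have hpc : 0 < c - inner ℝ p w := by linarith [hw p (interior_subset hp)]
  have hw0 : (c - inner ℝ p w)⁻¹ • w ∈ polarAt S p := by
    intro s hs
    have := hw s (subset_convexHull ℝ _ hs)
    rw [real_inner_smul_right, inner_sub_left, inv_mul_le_iff₀ hpc]
    linarith
  have hz0 : 1 < (inner ℝ (z - p) ((c - inner ℝ p w)⁻¹ • w) : ℝ) := by
    rw [real_inner_smul_right, inner_sub_left, lt_inv_mul_iff₀ hpc]
    linarith
  have hQ := isCompact_polarAt hp
  set E : Set (Euc d) :=
    {u ∈ polarAt S p | ∀ u' ∈ polarAt S p, (inner ℝ (z - p) u' : ℝ) ≤ inner ℝ (z - p) u} with hE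
  have hEc : IsCompact E := by
    refine hQ.of_isClosed_subset ?_ (sep_subset _ _)
    have : E = polarAt S p ∩
        ⋂ u' ∈ polarAt S p, {u | (inner ℝ (z - p) u' : ℝ) ≤ inner ℝ (z - p) u} := by
      ext u; simp [hE]
    rw [this]
    exact hQ.isClosed.inter
      (isClosed_biInter fun u' _ => isClosed_le continuous_const (by fun_prop))
  have hEne : E.Nonempty := by
    obtain ⟨u, hu, hmax⟩ := hQ.exists_isMaxOn ⟨_, hw0⟩
      (f := fun u => (inner ℝ (z - p) u : ℝ)) (by fun_prop)
    exact ⟨u, hu, fun u' hu' => hmax hu'⟩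
  obtain ⟨u, ⟨huQ, humax⟩, hext⟩ := hEc.extremePoints_nonempty hEne
  have huz : 1 < (inner ℝ (z - p) u : ℝ) := hz0.trans_le (humax _ hw0)
  have hu0 : u ≠ 0 := by
    rintro rfl
    rw [inner_zero_right] at huz
    linarith
  have hn : 0 < ‖u‖ := norm_pos_iff.2 hu0
  have hle : ∀ a ∈ convexHull ℝ (S : Set (Euc d)), (inner ℝ a u : ℝ) ≤ 1 + inner ℝ p u := by
    intro a ha
    refine inner_le_of_mem_convexHull (fun s hs => ?_) ha
    have := huQ s hs
    rw [inner_sub_left] at this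
    linarith
  have hspan : Submodule.span ℝ
      ((fun s => s - p) '' {s | s ∈ S ∧ (inner ℝ (s - p) u : ℝ) = 1}) = ⊤ := by
    rw [← Submodule.orthogonal_eq_bot_iff, Submodule.eq_bot_iff]
    intro y hy
    obtain ⟨ε, hε, hadd, hsub⟩ := exists_pos_add_sub_mem_polarAt (y := y) huQ fun s hs h =>
      (Submodule.mem_orthogonal _ _).1 hy _ (Submodule.subset_span ⟨s, ⟨hs, h⟩, rfl⟩)
    have h1 := humax _ hadd
    have h2 := humax _ hsub
    rw [inner_add_right] at h1
    rw [inner_sub_right] at h2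
    have h0 : (inner ℝ (z - p) (ε • y) : ℝ) = 0 := by linarith
    have hadd' : u + ε • y ∈ E := ⟨hadd, by rw [inner_add_right, h0, add_zero]; exact humax⟩
    have hsub' : u - ε • y ∈ E := ⟨hsub, by rw [inner_sub_right, h0, sub_zero]; exact humax⟩
    have h := hext hadd' hsub'
      ⟨1 / 2, 1 / 2, by norm_num, by norm_num, by norm_num, by module⟩
    rw [add_eq_left] at h
    exact (smul_eq_zero.1 h).resolve_left hε.ne'
  refine ⟨‖u‖⁻¹ • u, isFacetNormal_of_span_eq_top ?_ ?_ hspan, fun a ha => ?_⟩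
  · rw [norm_smul, norm_inv, norm_norm, inv_mul_cancel₀ hn.ne']
  · rintro s ⟨hs, h⟩
    refine ⟨subset_convexHull ℝ _ hs, fun a ha => ?_⟩
    rw [real_inner_smul_right, real_inner_smul_right]
    have := hle a ha
    rw [inner_sub_left] at h
    gcongr
    linarith
  · rw [real_inner_smul_right, real_inner_smul_right]
    have := hle a ha
    rw [inner_sub_left] at huz
    gcongr
    linarith

/-- A vertex of a polytope is the unique maximizer of some linear functional. -/
lemma IsPolytope.exists_forall_inner_lt {P : Set (Euc d)} (hP : IsPolytope P) {v : Euc d}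
    (hv : v ∈ P.extremePoints ℝ) : ∃ w : Euc d, ∀ a ∈ P, a ≠ v →
      (inner ℝ a w : ℝ) < inner ℝ v w := by
  obtain ⟨S, rfl, -⟩ := hP
  have hvS : v ∈ (S : Set (Euc d)) := extremePoints_convexHull_subset hv
  have hv' : v ∉ convexHull ℝ ((S : Set (Euc d)) \ {v}) := fun h =>
    (extremePoints_convexHull_subset (inter_extremePoints_subset_extremePoints_of_subset
      (convexHull_mono sdiff_subset) ⟨h, hv⟩)).2 rfl
  obtain ⟨w, c, hw, hc⟩ := exists_inner_lt_lt (convex_convexHull ℝ _)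
    (S.finite_toSet.sdiff.isCompact_convexHull ℝ).isClosed hv'
  refine ⟨w, fun a ha hav => ?_⟩
  have hins : a ∈ convexHull ℝ (insert v ((S : Set (Euc d)) \ {v})) := by
    rwa [insert_sdiff_singleton, insert_eq_of_mem hvS]
  rcases ((S : Set (Euc d)) \ {v}).eq_empty_or_nonempty with he | hne
  · rw [he] at hins
    simp only [insert_empty_eq, convexHull_singleton, mem_singleton_iff] at hins
    exact absurd hins hav
  rw [convexHull_insert hne, mem_convexJoin] at hins
  obtain ⟨v', rfl, b, hb, r, t, hr, ht, hrt, rfl⟩ := hins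
  have ht0 : 0 < t := by
    refine ht.lt_of_ne fun h => hav ?_
    have : r = 1 := by linarith
    rw [← h, this, one_smul, zero_smul, add_zero]
  rw [inner_add_left, real_inner_smul_left, real_inner_smul_left]
  have hr' : r = 1 - t := by linarith
  rw [hr']
  nlinarith [hw b hb]

lemma isCompact_convexHull_iUnion_homo {P : Set (Euc d)} (hP : IsPolytope P) {n : ℕ}
    (x : Fin n → Euc d) (τ : Fin n → ℝ) :
    IsCompact (convexHull ℝ (⋃ i, homo (x i) (τ i) P)) := by
  obtain ⟨S, rfl, -⟩ := hP
  have hh : ∀ i, homo (x i) (τ i) (convexHull ℝ (S : Set (Euc d))) =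
      convexHull ℝ (homo (x i) (τ i) (S : Set (Euc d))) := fun i => by
    rw [homo, homo, convexHull_add, convexHull_singleton, convexHull_smul]
  have heq : convexHull ℝ (⋃ i, homo (x i) (τ i) (convexHull ℝ (S : Set (Euc d)))) =
      convexHull ℝ (⋃ i, homo (x i) (τ i) (S : Set (Euc d))) := by
    simp only [hh]
    refine Subset.antisymm (convexHull_min (iUnion_subset fun i => ?_) (convex_convexHull ℝ _))
      (convexHull_mono (iUnion_mono fun i => subset_convexHull ℝ _))
    exact convexHull_mono (subset_iUnion (fun i => homo (x i) (τ i) (S : Set (Euc d))) i)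
  rw [heq]
  exact (Set.finite_iUnion fun i =>
    (finite_singleton _).add (S.finite_toSet.smul_set)).isCompact_convexHull ℝ

/-- For a weakly `k`-impassable family with `k ≤ d - 2`, every point of the convex hull can be
replaced by a point of some member with the same values of two given linear functionals, the
first of which is a facet normal. -/
lemma WIP.exists_mem_inner_eq {k n : ℕ} {P : Set (Euc d)} {x : Fin n → Euc d} {τ : Fin n → ℝ}
    (h : WIP k P x τ) (hd : 2 ≤ d) (hk : k ≤ d - 2) {u : Euc d} (hu : IsFacetNormal P u)
    (w : Euc d) {y : Euc d} (hy : y ∈ convexHull ℝ (⋃ i, homo (x i) (τ i) P)) :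
    ∃ i, ∃ p ∈ P, (inner ℝ (x i + τ i • p) u : ℝ) = inner ℝ y u ∧
      (inner ℝ (x i + τ i • p) w : ℝ) = inner ℝ y w := by
  have hV : k ≤ Module.finrank ℝ (Submodule.span ℝ ({u, w} : Set (Euc d)))ᗮ := by
    have h1 := Submodule.finrank_add_finrank_orthogonal (Submodule.span ℝ ({u, w} : Set (Euc d)))
    rw [finrank_euclideanSpace_fin] at h1
    classical
    have h2 := finrank_span_finset_le_card (R := ℝ) ({u, w} : Finset (Euc d))
    have h3 := Finset.card_le_two (a := u) (b := w)
    rw [Set.finrank, Finset.coe_pair] at h2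
    omega
  obtain ⟨W, hWV, hWk⟩ := exists_submodule_le_finrank_eq hV
  have hWu : ∀ a ∈ W, (inner ℝ a u : ℝ) = 0 := fun a ha =>
    (Submodule.mem_orthogonal' _ _).1 (hWV ha) u (Submodule.subset_span (by simp))
  have hWw : ∀ a ∈ W, (inner ℝ a w : ℝ) = 0 := fun a ha =>
    (Submodule.mem_orthogonal' _ _).1 (hWV ha) w (Submodule.subset_span (by simp))
  have hne : (exposedFaceAt P u).Nonempty := by
    rw [nonempty_iff_ne_empty]
    intro he
    have h2 := hu.2
    rw [he, AffineSubspace.span_empty, AffineSubspace.direction_bot, finrank_bot] at h2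
    omega
  obtain ⟨f, hf⟩ := hne
  obtain ⟨i, z, hzA, hz⟩ := h (AffineSubspace.mk' y W : Set (Euc d))
    ⟨_, rfl, ⟨y, AffineSubspace.self_mem_mk' y W⟩, by rw [AffineSubspace.direction_mk', hWk]⟩
    ⟨u, hu, f - y, by
      rintro _ ⟨a, ha, rfl⟩
      have ha' : a - y ∈ W := AffineSubspace.mem_mk'.1 ha
      have hmem : a - y ∈ (affineSpan ℝ (exposedFaceAt P u)).direction := by
        rw [hu.direction_eq, Submodule.mem_orthogonal_singleton_iff_inner_left]
        exact hWu _ ha'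
      have := AffineSubspace.vadd_mem_of_mem_direction hmem (subset_affineSpan ℝ _ hf)
      rw [vadd_eq_add] at this
      change f - y + a ∈ affineSpan ℝ (exposedFaceAt P u)
      rwa [show f - y + a = a - y + f by abel]⟩
    ⟨y, AffineSubspace.self_mem_mk' y W, hy⟩
  obtain ⟨p, hp, rfl⟩ := mem_homo.1 hz
  have hzW : x i + τ i • p - y ∈ W := AffineSubspace.mem_mk'.1 hzA
  have h1 := hWu _ hzW
  have h2 := hWw _ hzW
  rw [inner_sub_left] at h1 h2
  exact ⟨i, p, hp, by linarith, by linarith⟩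

/-- An interval covered by finitely many intervals is no longer than their total length. -/
lemma sub_le_sum_of_Ioc_subset {n : ℕ} {a b : ℝ} {l r : Fin n → ℝ} (hlr : ∀ i, l i ≤ r i)
    (h : Ioc a b ⊆ ⋃ i, Icc (l i) (r i)) : b - a ≤ ∑ i, (r i - l i) := by
  have h1 := (measure_mono (μ := volume) h).trans (measure_iUnion_fintype_le volume _)
  simp only [Real.volume_Ioc, Real.volume_Icc] at h1
  rw [← ENNReal.ofReal_sum_of_nonneg fun i _ => sub_nonneg.2 (hlr i)] at h1
  exact (ENNReal.ofReal_le_ofReal_iff (Finset.sum_nonneg fun i _ => sub_nonneg.2 (hlr i))).1 h1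

/-- If every point of a compact convex set `K` can be replaced by a point of a member
`x i + τ i • P` with the same values at `u` and `w`, then each value of `u` on `K` exceeding its
value at a `w`-maximal point comes from the part of a member beyond its `w`-maximal vertex. -/
lemma exists_inner_eq_of_inner_replacement {n : ℕ} {P K : Set (Euc d)} {x : Fin n → Euc d}
    {τ : Fin n → ℝ} (hτ : ∀ i, 0 < τ i) (hK : Convex ℝ K) (hKc : IsCompact K)
    (hsub : ∀ i, ∀ p ∈ P, x i + τ i • p ∈ K) {u w v φ y₁ : Euc d} (hv : v ∈ P)
    (hw : ∀ a ∈ P, a ≠ v → (inner ℝ a w : ℝ) < inner ℝ v w)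
    (hrep : ∀ y ∈ K, ∃ i, ∃ p ∈ P, (inner ℝ (x i + τ i • p) u : ℝ) = inner ℝ y u ∧
      (inner ℝ (x i + τ i • p) w : ℝ) = inner ℝ y w)
    (hφ : φ ∈ K) (hφmax : ∀ y ∈ K, (inner ℝ y w : ℝ) ≤ inner ℝ φ w) (hy₁ : y₁ ∈ K) {m : ℝ}
    (hm : m ∈ Ioc (inner ℝ φ u : ℝ) (inner ℝ y₁ u)) :
    ∃ i, ∃ p ∈ P, (inner ℝ (x i + τ i • p) u : ℝ) = m ∧ (inner ℝ v u : ℝ) ≤ inner ℝ p u := by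
  have cross : ∀ a ∈ K, m ≤ inner ℝ a u → ∃ t : ℝ, 0 ≤ t ∧ t < 1 ∧
      (inner ℝ ((1 - t) • a + t • φ) u : ℝ) = m ∧ (1 - t) • a + t • φ ∈ K := by
    intro a ha hma
    have hpos : 0 < inner ℝ a u - inner ℝ φ u := by linarith [hm.1]
    have ht1 : (inner ℝ a u - m) / (inner ℝ a u - inner ℝ φ u) < 1 := by
      rw [div_lt_one hpos]; linarith [hm.1]
    have ht0 : 0 ≤ (inner ℝ a u - m) / (inner ℝ a u - inner ℝ φ u) :=
      div_nonneg (by linarith) hpos.le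
    refine ⟨_, ht0, ht1, ?_, hK ha hφ (by linarith) ht0 (by ring)⟩
    rw [inner_add_left, real_inner_smul_left, real_inner_smul_left]
    field_simp
    ring
  have hslice : IsCompact (K ∩ {y | (inner ℝ y u : ℝ) = m}) :=
    hKc.inter_right (isClosed_eq (by fun_prop) continuous_const)
  obtain ⟨t, -, -, hteq, htK⟩ := cross y₁ hy₁ hm.2
  obtain ⟨y, ⟨hyK, hyu⟩, hymax⟩ := hslice.exists_isMaxOn ⟨_, htK, hteq⟩
    (f := fun y => (inner ℝ y w : ℝ)) (by fun_prop)
  have hyu : (inner ℝ y u : ℝ) = m := hyu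
  obtain ⟨i, p, hp, hpu, hpw⟩ := hrep y hyK
  refine ⟨i, p, hp, hpu.trans hyu, ?_⟩
  by_contra! hlt
  have hpv : p ≠ v := by rintro rfl; exact lt_irrefl _ hlt
  have hzK : x i + τ i • v ∈ K := hsub i v hv
  rw [inner_add_left, real_inner_smul_left] at hpu hpw
  have hzw : (inner ℝ y w : ℝ) < inner ℝ (x i + τ i • v) w := by
    rw [inner_add_left, real_inner_smul_left]
    nlinarith [hw p hp hpv, hτ i]
  have hzu : m ≤ (inner ℝ (x i + τ i • v) u : ℝ) := by
    rw [inner_add_left, real_inner_smul_left]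
    nlinarith [hτ i]
  obtain ⟨s, hs0, hs1, hseq, hsK⟩ := cross _ hzK hzu
  have hle : (inner ℝ ((1 - s) • (x i + τ i • v) + s • φ) w : ℝ) ≤ inner ℝ y w :=
    hymax ⟨hsK, hseq⟩
  rw [inner_add_left, real_inner_smul_left, real_inner_smul_left] at hle
  nlinarith [hφmax y hyK]

/-- For each vertex `v` of `P`, the hull of a weakly impassable family has a translate inside
`(∑ i, τ i) • P` that contains `(∑ i, τ i) • v`. -/
lemma WIP.exists_translate_subset {k n : ℕ} {P : Set (Euc d)} (hP : IsPolytope P)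
    {x : Fin n → Euc d} {τ : Fin n → ℝ} (h : WIP k P x τ) (hd : 2 ≤ d) (hk : k ≤ d - 2)
    (hn : 0 < n) (hτ : ∀ i, 0 < τ i) {v : Euc d} (hv : v ∈ P.extremePoints ℝ) :
    ∃ φ ∈ convexHull ℝ (⋃ i, homo (x i) (τ i) P),
      ∀ y ∈ convexHull ℝ (⋃ i, homo (x i) (τ i) P),
        y + ((∑ i, τ i) • v - φ) ∈ (∑ i, τ i) • P := by
  set K := convexHull ℝ (⋃ i, homo (x i) (τ i) P) with hKdef
  have hKc : IsCompact K := isCompact_convexHull_iUnion_homo hP x τ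
  have hKconv : Convex ℝ K := convex_convexHull ℝ _
  have hsub : ∀ i, ∀ p ∈ P, x i + τ i • p ∈ K := fun i p hp =>
    subset_convexHull ℝ _ (mem_iUnion.2 ⟨i, mem_homo.2 ⟨p, hp, rfl⟩⟩)
  have hτsum : 0 < ∑ i, τ i := Finset.sum_pos (fun i _ => hτ i) ⟨⟨0, hn⟩, Finset.mem_univ _⟩
  have hvP : v ∈ P := hv.1
  obtain ⟨w, hw⟩ := hP.exists_forall_inner_lt hv
  obtain ⟨φ, hφ, hφmax⟩ := hKc.exists_isMaxOn ⟨_, hsub ⟨0, hn⟩ v hvP⟩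
    (f := fun y => (inner ℝ y w : ℝ)) (by fun_prop)
  refine ⟨φ, hφ, fun y hy => ?_⟩
  by_contra hcon
  rw [mem_smul_set_iff_inv_smul_mem₀ hτsum.ne'] at hcon
  obtain ⟨u, hu, hlt⟩ := hP.exists_isFacetNormal_forall_lt hcon
  obtain ⟨p₁, hp₁, hmax⟩ := hP.isCompact.exists_isMaxOn hP.nonempty
    (f := fun a => (inner ℝ a u : ℝ)) (by fun_prop)
  have hcover : Ioc (inner ℝ φ u : ℝ) (inner ℝ y u) ⊆
      ⋃ i, Icc (inner ℝ (x i) u + τ i * inner ℝ v u) (inner ℝ (x i) u + τ i * inner ℝ p₁ u) := by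
    intro m hm
    obtain ⟨i, p, hp, rfl, hvp⟩ := exists_inner_eq_of_inner_replacement hτ hKconv hKc hsub hvP hw
      (fun y hy => h.exists_mem_inner_eq hd hk hu w hy) hφ (fun y hy => hφmax hy) hy hm
    rw [inner_add_left, real_inner_smul_left]
    have hp₁' : (inner ℝ p u : ℝ) ≤ inner ℝ p₁ u := hmax hp
    have hi := (hτ i).le
    exact mem_iUnion.2 ⟨i, by gcongr, by gcongr⟩
  have hlen := sub_le_sum_of_Ioc_subset (fun i => by
    have hvp₁ : (inner ℝ v u : ℝ) ≤ inner ℝ p₁ u := hmax hvP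
    have hi := (hτ i).le
    gcongr) hcover
  simp only [add_sub_add_left_eq_sub, ← mul_sub, ← Finset.sum_mul] at hlen
  have hlt₁ := hlt p₁ hp₁
  rw [real_inner_smul_left, inner_add_left, inner_sub_left, real_inner_smul_left,
    lt_inv_mul_iff₀ hτsum] at hlt₁
  linarith

/-- the convex hull of a weakly k-impassable family of positive
homothets of a d-polytope `P` is a summand of `(∑τᵢ)P`. -/
theorem stmt_15 (d k n : ℕ) (hd : 3 ≤ d) (hk1 : 1 ≤ k) (hk2 : k ≤ d - 2) (hn : 2 ≤ n)
    (P : Set (Euc d)) (hP : IsPolytope P)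
    (x : Fin n → Euc d) (τ : Fin n → ℝ) (hτ : ∀ i, 0 < τ i)
    (hWIP : WIP k P x τ) :
    (∃ K' : Set (Euc d), K'.Nonempty ∧ IsCompact K' ∧ Convex ℝ K' ∧
      convexHull ℝ (⋃ i, homo (x i) (τ i) P) + K' = (∑ i, τ i) • P) ∧
    ∃ c : Euc d, (⋃ i, homo (x i) (τ i) P) ⊆ homo c (∑ i, τ i) P := by
  set K := convexHull ℝ (⋃ i, homo (x i) (τ i) P) with hKdef
  have hKc : IsCompact K := isCompact_convexHull_iUnion_homo hP x τ
  have hKconv : Convex ℝ K := convex_convexHull ℝ _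
  have hPc := hP.isCompact
  have hTc : IsCompact ((∑ i, τ i) • P) := hPc.smul _
  have hτsum : 0 < ∑ i, τ i :=
    Finset.sum_pos (fun i _ => hτ i) ⟨⟨0, by omega⟩, Finset.mem_univ _⟩
  set K' : Set (Euc d) := {y | ∀ z ∈ K, z + y ∈ (∑ i, τ i) • P} with hK'
  have hvert : ∀ v ∈ P.extremePoints ℝ, ∃ φ ∈ K, (∑ i, τ i) • v - φ ∈ K' := fun v hv =>
    hWIP.exists_translate_subset hP (by omega) hk2 (by omega) hτ hv
  obtain ⟨v₀, hv₀⟩ := hPc.extremePoints_nonempty hP.nonempty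
  obtain ⟨φ₀, hφ₀, hφ₀'⟩ := hvert v₀ hv₀
  have hK'closed : IsClosed K' := by
    simp only [hK', ofPred_forall]
    exact isClosed_biInter fun z _ => hTc.isClosed.preimage (continuous_const_add z)
  have hK'c : IsCompact K' := by
    refine (hTc.image (continuous_sub_right φ₀)).of_isClosed_subset hK'closed fun y hy => ?_
    exact ⟨φ₀ + y, hy φ₀ hφ₀, by simp⟩
  have hK'conv : Convex ℝ K' := by
    intro a ha b hb r s hr hs hrs z hz
    have := hP.convex.smul (∑ i, τ i) (ha z hz) (hb z hz) hr hs hrs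
    rwa [smul_add, smul_add, add_add_add_comm, ← add_smul, hrs, one_smul] at this
  refine ⟨⟨K', ⟨_, hφ₀'⟩, hK'c, hK'conv, Subset.antisymm ?_ ?_⟩, -((∑ i, τ i) • v₀ - φ₀), ?_⟩
  · rintro _ ⟨z, hz, y, hy, rfl⟩
    exact hy z hz
  · rw [smul_set_subset_iff₀ hτsum.ne', ← closure_convexHull_extremePoints hPc hP.convex]
    refine closure_minimal (convexHull_min (fun v hv => ?_) ((hKconv.add hK'conv).smul _))
      ((hKc.add hK'c).smul _).isClosed
    obtain ⟨φ, hφ, hφ'⟩ := hvert v hv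
    exact (mem_inv_smul_set_iff₀ hτsum.ne' _ _).2 ⟨φ, hφ, _, hφ', add_sub_cancel _ _⟩
  · intro z hz
    obtain ⟨p, hp, hpz⟩ := hφ₀' z (subset_convexHull ℝ _ hz)
    exact mem_homo.2 ⟨p, hp, by simp only at hpz; rw [hpz]; abel⟩

end
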